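/- arXiv:1107.4104 — 5 statements merged into one kernel-verified Lean document; each statement's English description precedes it below -/
import Mathlib

section
/- Suppose every α_i ≠ 0, G(ς̄) is invertible, and ς̄ ∈ ℝ^m is a critical point of the canonical dual function P^d (i.e. the gradient of P^d vanishes at ς̄). Then the vector x̄ = G(ς̄)⁻¹ F(ς̄) is a critical point of P on ℝⁿ, i.e. the gradient of P vanishes at x̄. -/
open Matrix

/-- The primal function `P(x) = Σᵢ (αᵢ/2)(½xᵀAᵢx + bᵢᵀx + cᵢ)² + ½xᵀQx − xᵀf`. -/
noncomputable def primalP {n m : ℕ} (Q : Matrix (Fin n) (Fin n) ℝ)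
    (A : Fin m → Matrix (Fin n) (Fin n) ℝ) (f : Fin n → ℝ) (b : Fin m → Fin n → ℝ)
    (c α : Fin m → ℝ) (x : Fin n → ℝ) : ℝ :=
  (∑ i, α i / 2 * ((1 / 2) * (x ⬝ᵥ (A i).mulVec x) + b i ⬝ᵥ x + c i) ^ 2)
    + (1 / 2) * (x ⬝ᵥ Q.mulVec x) - x ⬝ᵥ f

/-- `F(ς) = f − Σᵢ ςᵢ bᵢ`. -/
noncomputable def Fvec {n m : ℕ} (f : Fin n → ℝ) (b : Fin m → Fin n → ℝ)
    (ς : Fin m → ℝ) : Fin n → ℝ :=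
  f - ∑ i, ς i • b i

/-- `G(ς) = Q + Σᵢ ςᵢ Aᵢ`. -/
noncomputable def Gmat {n m : ℕ} (Q : Matrix (Fin n) (Fin n) ℝ)
    (A : Fin m → Matrix (Fin n) (Fin n) ℝ) (ς : Fin m → ℝ) : Matrix (Fin n) (Fin n) ℝ :=
  Q + ∑ i, ς i • A i

/-- The canonical dual function
`P^d(ς) = Σᵢ (cᵢςᵢ − ςᵢ²/(2αᵢ)) − ½ F(ς)ᵀ G(ς)⁻¹ F(ς)`. -/
noncomputable def dualP {n m : ℕ} (Q : Matrix (Fin n) (Fin n) ℝ)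
    (A : Fin m → Matrix (Fin n) (Fin n) ℝ) (f : Fin n → ℝ) (b : Fin m → Fin n → ℝ)
    (c α : Fin m → ℝ) (ς : Fin m → ℝ) : ℝ :=
  (∑ i, (c i * ς i - ς i ^ 2 / (2 * α i)))
    - (1 / 2) * (Fvec f b ς ⬝ᵥ (Gmat Q A ς)⁻¹.mulVec (Fvec f b ς))

/-- The Gao–Strang complementary function
`Ξ(x,ς) = Σᵢ [(½xᵀAᵢx + bᵢᵀx + cᵢ)ςᵢ − ςᵢ²/(2αᵢ)] + ½xᵀQx − xᵀf`. -/
noncomputable def GaoStrangXi {n m : ℕ} (Q : Matrix (Fin n) (Fin n) ℝ)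
    (A : Fin m → Matrix (Fin n) (Fin n) ℝ) (f : Fin n → ℝ) (b : Fin m → Fin n → ℝ)
    (c α : Fin m → ℝ) (x : Fin n → ℝ) (ς : Fin m → ℝ) : ℝ :=
  (∑ i, (((1 / 2) * (x ⬝ᵥ (A i).mulVec x) + b i ⬝ᵥ x + c i) * ς i - ς i ^ 2 / (2 * α i)))
    + (1 / 2) * (x ⬝ᵥ Q.mulVec x) - x ⬝ᵥ f

theorem aux_dot {n : ℕ} {u v : ℝ → Fin n → ℝ} {u' v' : Fin n → ℝ} {t : ℝ}
    (hu : HasDerivAt u u' t) (hv : HasDerivAt v v' t) :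
    HasDerivAt (fun s => u s ⬝ᵥ v s) (u' ⬝ᵥ v t + u t ⬝ᵥ v') t := by
  rw [hasDerivAt_pi] at hu hv
  simp only [dotProduct, ← Finset.sum_add_distrib]
  exact HasDerivAt.fun_sum fun i _ => (hu i).mul (hv i)

theorem aux_det {m k : ℕ} {M : (Fin m → ℝ) → Matrix (Fin k) (Fin k) ℝ} {x : Fin m → ℝ}
    (h : ∀ i j, DifferentiableAt ℝ (fun s => M s i j) x) :
    DifferentiableAt ℝ (fun s => (M s).det) x := by
  simp only [Matrix.det_apply']
  fun_prop

theorem aux_inv {m k : ℕ} {M : (Fin m → ℝ) → Matrix (Fin k) (Fin k) ℝ} {x : Fin m → ℝ}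
    (h : ∀ i j, DifferentiableAt ℝ (fun s => M s i j) x) (hx : IsUnit (M x)) (i j : Fin k) :
    DifferentiableAt ℝ (fun s => (M s)⁻¹ i j) x := by
  simp only [Matrix.inv_def, Ring.inverse_eq_inv', Matrix.smul_apply, smul_eq_mul,
    Matrix.adjugate_apply]
  have hd : (M x).det ≠ 0 := ((Matrix.isUnit_iff_isUnit_det _).1 hx).ne_zero
  refine ((aux_det h).inv hd).mul (aux_det ?_)
  intro a c
  by_cases hc : a = j
  · subst hc; simp
  · simpa [Matrix.updateRow_apply, hc] using h a c

theorem aux_symm {n : ℕ} {S : Matrix (Fin n) (Fin n) ℝ} (hS : S.IsSymm) (u v : Fin n → ℝ) :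
    u ⬝ᵥ S.mulVec v = S.mulVec u ⬝ᵥ v := by
  rw [Matrix.dotProduct_mulVec, ← Matrix.mulVec_transpose, hS.eq]

theorem aux_Gsymm {n m : ℕ} {Q : Matrix (Fin n) (Fin n) ℝ}
    {A : Fin m → Matrix (Fin n) (Fin n) ℝ} (hQ : Q.IsSymm) (hA : ∀ i, (A i).IsSymm)
    (s : Fin m → ℝ) : (Gmat Q A s).IsSymm := by
  unfold Gmat Matrix.IsSymm
  rw [Matrix.transpose_add, hQ.eq, Matrix.transpose_sum]
  simp only [Matrix.transpose_smul, (hA _).eq]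

theorem aux_F {n m : ℕ} (f : Fin n → ℝ) (b : Fin m → Fin n → ℝ) (s : Fin m → ℝ) (i : Fin m)
    (t : ℝ) : Fvec f b (s + t • Pi.single i 1) = Fvec f b s - t • b i := by
  simp [Fvec, add_smul, Finset.sum_add_distrib, Pi.single_apply, sub_sub]

theorem aux_G {n m : ℕ} (Q : Matrix (Fin n) (Fin n) ℝ)
    (A : Fin m → Matrix (Fin n) (Fin n) ℝ) (s : Fin m → ℝ) (i : Fin m)
    (t : ℝ) : Gmat Q A (s + t • Pi.single i 1) = Gmat Q A s + t • A i := by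
  simp [Gmat, add_smul, Finset.sum_add_distrib, Pi.single_apply, add_assoc]

theorem aux_Xdiff {n m : ℕ} (Q : Matrix (Fin n) (Fin n) ℝ)
    (A : Fin m → Matrix (Fin n) (Fin n) ℝ) (f : Fin n → ℝ) (b : Fin m → Fin n → ℝ)
    (s : Fin m → ℝ) (hG : IsUnit (Gmat Q A s)) :
    DifferentiableAt ℝ (fun r => (Gmat Q A r)⁻¹.mulVec (Fvec f b r)) s := by
  rw [differentiableAt_pi]
  intro i
  have h := aux_inv (M := Gmat Q A) (x := s) (by
    intro i j
    simp only [Gmat, Matrix.add_apply, Matrix.sum_apply, Matrix.smul_apply, smul_eq_mul]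
    fun_prop) hG
  unfold Matrix.mulVec dotProduct
  refine DifferentiableAt.fun_sum fun j _ => DifferentiableAt.mul (h i j) ?_
  simp only [Fvec, Pi.sub_apply, Finset.sum_apply, Pi.smul_apply, smul_eq_mul]
  fun_prop

theorem aux_dualdiff {n m : ℕ} (Q : Matrix (Fin n) (Fin n) ℝ)
    (A : Fin m → Matrix (Fin n) (Fin n) ℝ) (f : Fin n → ℝ) (b : Fin m → Fin n → ℝ)
    (c α : Fin m → ℝ) (s : Fin m → ℝ) (hG : IsUnit (Gmat Q A s)) :
    DifferentiableAt ℝ (dualP Q A f b c α) s := by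
  have h := aux_Xdiff Q A f b s hG
  rw [differentiableAt_pi] at h
  unfold dualP
  simp only [div_eq_mul_inv]
  refine DifferentiableAt.sub (by fun_prop) (DifferentiableAt.const_mul ?_ _)
  unfold dotProduct
  refine DifferentiableAt.fun_sum fun i _ => DifferentiableAt.mul ?_ (h i)
  simp only [Fvec, Pi.sub_apply, Finset.sum_apply, Pi.smul_apply, smul_eq_mul]
  fun_prop

theorem aux_line {k : ℕ} (s e : Fin k → ℝ) : HasDerivAt (fun t : ℝ => s + t • e) e 0 := by
  simpa using ((hasDerivAt_id (0 : ℝ)).smul_const e).const_add s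

theorem aux_dual {n m : ℕ} (Q : Matrix (Fin n) (Fin n) ℝ)
    (A : Fin m → Matrix (Fin n) (Fin n) ℝ) (f : Fin n → ℝ) (b : Fin m → Fin n → ℝ)
    (c α : Fin m → ℝ) (hQ : Q.IsSymm) (hA : ∀ i, (A i).IsSymm)
    (s : Fin m → ℝ) (hG : IsUnit (Gmat Q A s))
    (hcrit : fderiv ℝ (dualP Q A f b c α) s = 0) (x : Fin n → ℝ)
    (hx : x = (Gmat Q A s)⁻¹.mulVec (Fvec f b s)) (i : Fin m) :
    (1 / 2) * (x ⬝ᵥ (A i).mulVec x) + b i ⬝ᵥ x + c i = s i / α i := by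
  have hd0 : s + (0 : ℝ) • (Pi.single i 1 : Fin m → ℝ) = s := by simp
  have hl := aux_line s (Pi.single i 1)
  -- derivative of the dual along the line
  have h1 : HasDerivAt (fun t : ℝ => dualP Q A f b c α (s + t • Pi.single i 1)) 0 0 := by
    have h := (aux_dualdiff Q A f b c α s hG).hasFDerivAt
    rw [hcrit] at h
    rw [← hd0] at h
    exact h.comp_hasDerivAt (0 : ℝ) hl
  -- the curve of minimizers
  obtain ⟨X', hX⟩ : ∃ X', HasDerivAt (fun t : ℝ => (Gmat Q A (s + t • Pi.single i 1))⁻¹.mulVec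
      (Fvec f b (s + t • Pi.single i 1))) X' 0 := by
    have h := (aux_Xdiff Q A f b s hG).hasFDerivAt
    rw [← hd0] at h
    have h' := h.comp_hasDerivAt (0 : ℝ) hl
    exact ⟨_, h'⟩
  set X := (fun t : ℝ => (Gmat Q A (s + t • Pi.single i 1))⁻¹.mulVec
      (Fvec f b (s + t • Pi.single i 1))) with hXdef
  have hX0 : X 0 = x := by simp [hXdef, hx]
  have hdet : (Gmat Q A s).det ≠ 0 := ((Matrix.isUnit_iff_isUnit_det _).1 hG).ne_zero
  have hGx : (Gmat Q A s).mulVec x = Fvec f b s := by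
    rw [hx, Matrix.mulVec_mulVec, Matrix.mul_nonsing_inv _ hdet.isUnit, Matrix.one_mulVec]
  have hev : ∀ᶠ t in nhds (0 : ℝ), (Gmat Q A (s + t • Pi.single i 1)).det ≠ 0 := by
    have hc : Continuous fun t : ℝ => (Gmat Q A (s + t • Pi.single i 1)).det := by
      apply Continuous.matrix_det
      simp only [aux_G]
      fun_prop
    exact hc.continuousAt.eventually_ne (by simpa using hdet)
  have hev2 : (fun t : ℝ => Fvec f b s ⬝ᵥ X t + t * ((A i).mulVec x ⬝ᵥ X t) + t * (x ⬝ᵥ b i))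
      =ᶠ[nhds 0] fun _ => x ⬝ᵥ Fvec f b s := by
    filter_upwards [hev] with t ht
    have h : (Gmat Q A s + t • A i).mulVec (X t) = Fvec f b s - t • b i := by
      rw [← aux_G, ← aux_F, hXdef, Matrix.mulVec_mulVec, Matrix.mul_nonsing_inv _ ht.isUnit,
        Matrix.one_mulVec]
    have h' := congrArg (fun y => x ⬝ᵥ y) h
    simp only [Matrix.add_mulVec, Matrix.smul_mulVec, dotProduct_add, dotProduct_sub,
      dotProduct_smul, smul_eq_mul, aux_symm (aux_Gsymm hQ hA s), aux_symm (hA i), hGx] at h'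
    linarith
  have h2 : Fvec f b s ⬝ᵥ X' + (A i).mulVec x ⬝ᵥ x + x ⬝ᵥ b i = 0 := by
    have ha := aux_dot (hasDerivAt_const (0 : ℝ) (Fvec f b s)) hX
    have hb := aux_dot (hasDerivAt_const (0 : ℝ) ((A i).mulVec x)) hX
    have hc := (ha.add ((hasDerivAt_id (0 : ℝ)).mul hb)).add
      ((hasDerivAt_id (0 : ℝ)).mul_const (x ⬝ᵥ b i))
    have hz := (hasDerivAt_const (0 : ℝ) (x ⬝ᵥ Fvec f b s)).congr_of_eventuallyEq hev2
    have := hc.unique hz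
    simpa [hX0] using this
  have h3 : HasDerivAt (fun t : ℝ => dualP Q A f b c α (s + t • Pi.single i 1))
      ((c i - s i / α i) - (1 / 2) * (-(b i ⬝ᵥ x) + Fvec f b s ⬝ᵥ X')) 0 := by
    unfold dualP
    refine HasDerivAt.sub ?_ (HasDerivAt.const_mul _ ?_)
    · have : c i - s i / α i = ∑ j, (if j = i then c i - s i / α i else 0) := by simp
      rw [this]
      refine HasDerivAt.fun_sum fun j _ => ?_
      by_cases hj : j = i
      · subst hj
        have e := (hasDerivAt_id (0 : ℝ)).const_add (s j)
        have e2 := (e.const_mul (c j)).sub ((e.pow 2).div_const (2 * α j))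
        simp only [Pi.add_apply, Pi.smul_apply, Pi.single_eq_same, smul_eq_mul, mul_one, if_true]
        refine e2.congr_deriv ?_
        simp [mul_div_mul_left]
      · simp only [Pi.add_apply, Pi.smul_apply, Pi.single_eq_of_ne hj, smul_zero, add_zero, hj, if_false]
        exact hasDerivAt_const (0 : ℝ) (c j * s j - s j ^ 2 / (2 * α j))
    · have hF : HasDerivAt (fun t : ℝ => Fvec f b (s + t • Pi.single i 1)) (-b i) 0 := by
        simp only [aux_F]
        simpa using ((hasDerivAt_id (0 : ℝ)).smul_const (b i)).const_sub (Fvec f b s)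
      have := aux_dot hF hX
      simpa [hX0] using this
  have h4 := h3.unique h1
  rw [aux_symm (hA i)]
  rw [dotProduct_comm x (b i)] at h2
  linarith

theorem aux_primaldiff {n m : ℕ} (Q : Matrix (Fin n) (Fin n) ℝ)
    (A : Fin m → Matrix (Fin n) (Fin n) ℝ) (f : Fin n → ℝ) (b : Fin m → Fin n → ℝ)
    (c α : Fin m → ℝ) : Differentiable ℝ (primalP Q A f b c α) := by
  unfold primalP Matrix.mulVec dotProduct
  fun_prop

theorem aux_quad {n : ℕ} {S : Matrix (Fin n) (Fin n) ℝ} (hS : S.IsSymm) (x v : Fin n → ℝ) :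
    HasDerivAt (fun t : ℝ => (1 / 2) * ((x + t • v) ⬝ᵥ S.mulVec (x + t • v)))
      (S.mulVec x ⬝ᵥ v) 0 := by
  have hS' : HasDerivAt (fun t : ℝ => S.mulVec (x + t • v)) (S.mulVec v) 0 := by
    simp only [Matrix.mulVec_add, Matrix.mulVec_smul]
    exact aux_line _ _
  refine ((aux_dot (aux_line x v) hS').const_mul (1 / 2)).congr_deriv ?_
  simp only [zero_smul, add_zero]
  rw [aux_symm hS x v, dotProduct_comm v]
  ring

/-- If every `αᵢ ≠ 0`, `G(ς̄)` is invertible and `ς̄` is a critical point of the canonical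
dual function `P^d`, then `x̄ = G(ς̄)⁻¹ F(ς̄)` is a critical point of `P` on `ℝⁿ`. -/
theorem critical_point_duality {n m : ℕ} (Q : Matrix (Fin n) (Fin n) ℝ)
    (A : Fin m → Matrix (Fin n) (Fin n) ℝ) (f : Fin n → ℝ) (b : Fin m → Fin n → ℝ)
    (c α : Fin m → ℝ) (hQ : Q.IsSymm) (hA : ∀ i, (A i).IsSymm)
    (hα : ∀ i, α i ≠ 0) (ςb : Fin m → ℝ)
    (hG : IsUnit (Gmat Q A ςb))
    (hcrit : fderiv ℝ (dualP Q A f b c α) ςb = 0) :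
    fderiv ℝ (primalP Q A f b c α) ((Gmat Q A ςb)⁻¹.mulVec (Fvec f b ςb)) = 0 := by
  set x := (Gmat Q A ςb)⁻¹.mulVec (Fvec f b ςb) with hx
  have key := aux_dual Q A f b c α hQ hA ςb hG hcrit x hx
  have hdet : (Gmat Q A ςb).det ≠ 0 := ((Matrix.isUnit_iff_isUnit_det _).1 hG).ne_zero
  have hGx : (Gmat Q A ςb).mulVec x = Fvec f b ςb := by
    rw [hx, Matrix.mulVec_mulVec, Matrix.mul_nonsing_inv _ hdet.isUnit, Matrix.one_mulVec]
  ext1 v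
  have h0 : x + (0 : ℝ) • v = x := by simp
  have h1 : HasDerivAt (fun t : ℝ => primalP Q A f b c α (x + t • v))
      (fderiv ℝ (primalP Q A f b c α) x v) 0 := by
    have h := (aux_primaldiff Q A f b c α x).hasFDerivAt
    have hl := aux_line x v
    generalize fderiv ℝ (primalP Q A f b c α) x = L at h ⊢
    rw [← h0] at h
    exact h.comp_hasDerivAt (0 : ℝ) hl
  have h2 : HasDerivAt (fun t : ℝ => primalP Q A f b c α (x + t • v))
      ((∑ i, ςb i * ((A i).mulVec x ⬝ᵥ v + b i ⬝ᵥ v)) + Q.mulVec x ⬝ᵥ v - v ⬝ᵥ f) 0 := by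
    unfold primalP
    refine ((HasDerivAt.fun_sum fun i _ => ?_).add (aux_quad hQ x v)).sub ?_
    · have hb := aux_dot (hasDerivAt_const (0 : ℝ) (b i)) (aux_line x v)
      have e := ((((aux_quad (hA i) x v).add hb).add_const (c i)).pow 2).const_mul (α i / 2)
      refine e.congr_deriv ?_
      have k := key i
      simp only [Pi.add_apply, h0, zero_dotProduct, zero_add, k]
      have := hα i
      have k2 : α i * (ςb i / α i) = ςb i := by field_simp
      have k3 : ∀ z : ℝ, α i / 2 * ((2 : ℕ) * (ςb i / α i) ^ (2 - 1) * z)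
          = α i * (ςb i / α i) * z := by
        intro z; norm_num; ring
      rw [k3, k2]
    · simpa using aux_dot (aux_line x v) (hasDerivAt_const (0 : ℝ) f)
  rw [h1.unique h2]
  have h3 := congrArg (fun y => y ⬝ᵥ v) hGx
  simp only [Gmat, Fvec, Matrix.add_mulVec, Matrix.sum_mulVec, Matrix.smul_mulVec, add_dotProduct,
    sub_dotProduct, sum_dotProduct, smul_dotProduct, smul_eq_mul] at h3
  simp only [mul_add, Finset.sum_add_distrib, dotProduct_comm v f]
  simp only [_root_.zero_apply]
  linarith
end

section
/- Suppose every α_i > 0, ς̄ ∈ ℝ^m is a critical point of the canonical dual function P^d, and G(ς̄) is positive definite. Then x̄ = G(ς̄)⁻¹ F(ς̄) is a global minimizer of P on ℝⁿ: for every x ∈ ℝⁿ, P(x̄) ≤ P(x). -/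
open Matrix

lemma xi_eq_quad {n m : ℕ} (Q : Matrix (Fin n) (Fin n) ℝ)
    (A : Fin m → Matrix (Fin n) (Fin n) ℝ) (f : Fin n → ℝ) (b : Fin m → Fin n → ℝ)
    (c α : Fin m → ℝ) (x : Fin n → ℝ) (ς : Fin m → ℝ) :
    GaoStrangXi Q A f b c α x ς = (∑ i, (c i * ς i - ς i ^ 2 / (2 * α i)))
      + (1 / 2) * (x ⬝ᵥ (Gmat Q A ς).mulVec x) - x ⬝ᵥ Fvec f b ς := by
  unfold GaoStrangXi Gmat Fvec
  have h1 : x ⬝ᵥ (Q + ∑ i, ς i • A i).mulVec x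
      = x ⬝ᵥ Q.mulVec x + ∑ i, ς i * (x ⬝ᵥ (A i).mulVec x) := by
    rw [Matrix.add_mulVec, dotProduct_add, Matrix.sum_mulVec, dotProduct_sum]
    simp [Matrix.smul_mulVec]
  have h2 : x ⬝ᵥ (f - ∑ i, ς i • b i) = x ⬝ᵥ f - ∑ i, ς i * (b i ⬝ᵥ x) := by
    rw [dotProduct_sub, dotProduct_sum]
    simp [dotProduct_comm x]
  rw [h1, h2]
  have h3 : (∑ i, (((1 / 2) * (x ⬝ᵥ (A i).mulVec x) + b i ⬝ᵥ x + c i) * ς i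
      - ς i ^ 2 / (2 * α i))) = (∑ i, (c i * ς i - ς i ^ 2 / (2 * α i)))
      + (1/2) * (∑ i, ς i * (x ⬝ᵥ (A i).mulVec x)) + ∑ i, ς i * (b i ⬝ᵥ x) := by
    rw [Finset.mul_sum, ← Finset.sum_add_distrib, ← Finset.sum_add_distrib]
    exact Finset.sum_congr rfl fun i _ => by ring
  rw [h3]; ring

lemma Gmat_symm {n m : ℕ} (Q : Matrix (Fin n) (Fin n) ℝ)
    (A : Fin m → Matrix (Fin n) (Fin n) ℝ) (hQ : Q.IsSymm) (hA : ∀ i, (A i).IsSymm)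
    (ς : Fin m → ℝ) : (Gmat Q A ς).IsSymm := by
  unfold Gmat Matrix.IsSymm
  rw [Matrix.transpose_add, hQ.eq, Matrix.transpose_sum]
  simp [fun i => (hA i).eq]

lemma xi_eq_dual {n m : ℕ} (Q : Matrix (Fin n) (Fin n) ℝ)
    (A : Fin m → Matrix (Fin n) (Fin n) ℝ) (f : Fin n → ℝ) (b : Fin m → Fin n → ℝ)
    (c α : Fin m → ℝ) (hQ : Q.IsSymm) (hA : ∀ i, (A i).IsSymm)
    (x : Fin n → ℝ) (ς : Fin m → ℝ) (hdet : IsUnit (Gmat Q A ς).det) :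
    GaoStrangXi Q A f b c α x ς = dualP Q A f b c α ς
      + (1 / 2) * (((Gmat Q A ς).mulVec x - Fvec f b ς) ⬝ᵥ
        (Gmat Q A ς)⁻¹.mulVec ((Gmat Q A ς).mulVec x - Fvec f b ς)) := by
  have hs := Gmat_symm Q A hQ hA ς
  rw [xi_eq_quad]
  unfold dualP
  generalize Gmat Q A ς = G at *
  generalize Fvec f b ς = F at *
  have e1 : G⁻¹.mulVec (G.mulVec x) = x := by
    rw [Matrix.mulVec_mulVec, Matrix.nonsing_inv_mul _ hdet, Matrix.one_mulVec]
  have e2 : G.mulVec x ⬝ᵥ G⁻¹.mulVec F = x ⬝ᵥ F := by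
    rw [dotProduct_comm, Matrix.dotProduct_mulVec, ← Matrix.mulVec_transpose, hs.eq,
      Matrix.mulVec_mulVec, Matrix.mul_nonsing_inv _ hdet, Matrix.one_mulVec, dotProduct_comm]
  rw [Matrix.mulVec_sub, e1, sub_dotProduct, dotProduct_sub, dotProduct_sub, e2,
    dotProduct_comm F x, dotProduct_comm (G.mulVec x) x]
  ring

lemma hasFDerivAt_xi {n m : ℕ} (Q : Matrix (Fin n) (Fin n) ℝ)
    (A : Fin m → Matrix (Fin n) (Fin n) ℝ) (f : Fin n → ℝ) (b : Fin m → Fin n → ℝ)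
    (c α : Fin m → ℝ) (x : Fin n → ℝ) (ς : Fin m → ℝ) :
    HasFDerivAt (fun s => GaoStrangXi Q A f b c α x s)
      (∑ i, (((1 / 2) * (x ⬝ᵥ (A i).mulVec x) + b i ⬝ᵥ x + c i) - ς i / α i) •
        (ContinuousLinearMap.proj i : (Fin m → ℝ) →L[ℝ] ℝ)) ς := by
  unfold GaoStrangXi
  refine ((HasFDerivAt.fun_sum fun i _ => ?_).add_const _).sub_const _
  have hp : HasFDerivAt (fun s : Fin m → ℝ => s i)
      (ContinuousLinearMap.proj i : (Fin m → ℝ) →L[ℝ] ℝ) ς := hasFDerivAt_apply i ς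
  have hd : HasDerivAt (fun t : ℝ => ((1 / 2) * (x ⬝ᵥ (A i).mulVec x) + b i ⬝ᵥ x + c i) * t
      - t ^ 2 / (2 * α i))
      (((1 / 2) * (x ⬝ᵥ (A i).mulVec x) + b i ⬝ᵥ x + c i) - ς i / α i) (ς i) := by
    have := ((hasDerivAt_id (ς i)).const_mul
      ((1 / 2) * (x ⬝ᵥ (A i).mulVec x) + b i ⬝ᵥ x + c i)).sub
      (((hasDerivAt_id (ς i)).pow 2).div_const (2 * α i))
    refine HasDerivAt.congr_deriv (f' := _) this ?_
    rw [Nat.cast_ofNat, show (2 - 1 : ℕ) = 1 from rfl, pow_one, mul_one, mul_one,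
      mul_div_mul_left _ _ two_ne_zero, id]
  exact hd.comp_hasFDerivAt ς hp

lemma continuous_Gmat {n m : ℕ} (Q : Matrix (Fin n) (Fin n) ℝ)
    (A : Fin m → Matrix (Fin n) (Fin n) ℝ) : Continuous (Gmat Q A) := by
  unfold Gmat
  fun_prop

lemma hasFDerivAt_rem {n m : ℕ} (Q : Matrix (Fin n) (Fin n) ℝ)
    (A : Fin m → Matrix (Fin n) (Fin n) ℝ) (f : Fin n → ℝ) (b : Fin m → Fin n → ℝ)
    (x : Fin n → ℝ) (ς : Fin m → ℝ) (hdet : IsUnit (Gmat Q A ς).det)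
    (hx : (Gmat Q A ς).mulVec x - Fvec f b ς = 0) :
    HasFDerivAt (fun s => (1 / 2) * (((Gmat Q A s).mulVec x - Fvec f b s) ⬝ᵥ
        (Gmat Q A s)⁻¹.mulVec ((Gmat Q A s).mulVec x - Fvec f b s)))
      (0 : (Fin m → ℝ) →L[ℝ] ℝ) ς := by
  have hr : ∀ j, DifferentiableAt ℝ
      (fun s => ((Gmat Q A s).mulVec x - Fvec f b s) j) ς := by
    intro j
    simp only [Gmat, Fvec, Matrix.mulVec, dotProduct, Pi.sub_apply, Matrix.add_apply,
      Matrix.sum_apply, Finset.sum_apply, Matrix.smul_apply, Pi.smul_apply, smul_eq_mul]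
    fun_prop
  have hdc : Continuous fun s => (Gmat Q A s).det := (continuous_Gmat Q A).matrix_det
  have hinv : ContinuousAt (fun s => (Gmat Q A s)⁻¹) ς := by
    simp only [Matrix.inv_def, Ring.inverse_eq_inv']
    exact (hdc.continuousAt.inv₀ hdet.ne_zero).smul
      (continuous_Gmat Q A).matrix_adjugate.continuousAt
  have hrc : ContinuousAt (fun s => (Gmat Q A s).mulVec x - Fvec f b s) ς :=
    continuousAt_pi.2 fun j => (hr j).continuousAt
  have hs : ContinuousAt (fun s => (Gmat Q A s)⁻¹.mulVec ((Gmat Q A s).mulVec x - Fvec f b s)) ς := by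
    have : Continuous fun p : Matrix (Fin n) (Fin n) ℝ × (Fin n → ℝ) => p.1.mulVec p.2 := by
      fun_prop
    exact this.continuousAt.comp (hinv.prodMk hrc)
  have hmul : ∀ j, HasFDerivAt (fun s => ((Gmat Q A s).mulVec x - Fvec f b s) j *
      ((Gmat Q A s)⁻¹.mulVec ((Gmat Q A s).mulVec x - Fvec f b s)) j)
      (0 : (Fin m → ℝ) →L[ℝ] ℝ) ς := by
    intro j
    have h0 : ((Gmat Q A ς).mulVec x - Fvec f b ς) j = 0 := by rw [hx]; rfl
    have hO := (hr j).hasFDerivAt.isBigO_sub.norm_right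
    have hsj : Filter.Tendsto (fun s => ((Gmat Q A s)⁻¹.mulVec
        ((Gmat Q A s).mulVec x - Fvec f b s)) j) (nhds ς) (nhds 0) := by
      have := (continuousAt_pi.1 hs j).tendsto
      rw [hx] at this
      simpa using this
    have ho := hO.mul_isLittleO ((Asymptotics.isLittleO_one_iff ℝ).2 hsj)
    rw [hasFDerivAt_iff_isLittleO]
    simp only [h0, sub_zero, zero_mul, ContinuousLinearMap.zero_apply, mul_one] at ho ⊢
    exact ho.of_norm_right
  have := (HasFDerivAt.fun_sum fun j (_ : j ∈ Finset.univ) => hmul j).const_mul (1/2 : ℝ)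
  simpa [dotProduct] using this

/-- If every `αᵢ > 0`, `ς̄` is a critical point of `P^d` and `G(ς̄)` is positive definite,
then `x̄ = G(ς̄)⁻¹ F(ς̄)` is a global minimizer of `P` on `ℝⁿ`. -/
theorem global_min_of_posdef {n m : ℕ} (Q : Matrix (Fin n) (Fin n) ℝ)
    (A : Fin m → Matrix (Fin n) (Fin n) ℝ) (f : Fin n → ℝ) (b : Fin m → Fin n → ℝ)
    (c α : Fin m → ℝ) (hQ : Q.IsSymm) (hA : ∀ i, (A i).IsSymm)
    (hα : ∀ i, 0 < α i) (ςb : Fin m → ℝ)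
    (hcrit : fderiv ℝ (dualP Q A f b c α) ςb = 0)
    (hG : (Gmat Q A ςb).PosDef) :
    ∀ x : Fin n → ℝ,
      primalP Q A f b c α ((Gmat Q A ςb)⁻¹.mulVec (Fvec f b ςb)) ≤ primalP Q A f b c α x := by
  intro x
  have hdet : IsUnit (Gmat Q A ςb).det := hG.det_pos.ne'.isUnit
  set xb := (Gmat Q A ςb)⁻¹.mulVec (Fvec f b ςb) with hxb
  have hx : (Gmat Q A ςb).mulVec xb - Fvec f b ςb = 0 := by
    rw [hxb, Matrix.mulVec_mulVec, Matrix.mul_nonsing_inv _ hdet, Matrix.one_mulVec, sub_self]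
  have hD := (hasFDerivAt_xi Q A f b c α xb ςb).sub (hasFDerivAt_rem Q A f b xb ςb hdet hx)
  have hev : ∀ᶠ s in nhds ςb, IsUnit (Gmat Q A s).det := by
    have hdc : Continuous fun s => (Gmat Q A s).det := (continuous_Gmat Q A).matrix_det
    filter_upwards [hdc.continuousAt.eventually_ne hdet.ne_zero] with s hs using hs.isUnit
  have hD' := hD.congr_of_eventuallyEq (f₁ := dualP Q A f b c α) (by
    filter_upwards [hev] with s hs
    simp only [Pi.sub_apply]
    rw [xi_eq_dual Q A f b c α hQ hA xb s hs]
    ring)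
  have hz := hD'.fderiv.symm.trans hcrit
  have hς : ∀ i, ςb i = α i * ((1 / 2) * (xb ⬝ᵥ (A i).mulVec xb) + b i ⬝ᵥ xb + c i) := by
    intro i
    have := congrArg (fun L : (Fin m → ℝ) →L[ℝ] ℝ => L (Pi.single i 1)) hz
    simp only [sub_zero, ContinuousLinearMap.sum_apply, ContinuousLinearMap.smul_apply,
      ContinuousLinearMap.proj_apply, Pi.single_apply, smul_eq_mul, mul_ite, mul_one, mul_zero,
      Finset.sum_ite_eq', Finset.sum_ite_eq, Finset.mem_univ, if_true,
      ContinuousLinearMap.zero_apply] at this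
    have ha := (hα i).ne'
    rw [sub_eq_zero, eq_div_iff ha] at this
    rw [← this]; ring
  have hP : primalP Q A f b c α xb = GaoStrangXi Q A f b c α xb ςb := by
    unfold primalP GaoStrangXi
    congr 2
    refine Finset.sum_congr rfl fun i _ => ?_
    rw [hς i]
    have ha := (hα i).ne'
    field_simp
    ring
  have hP2 : GaoStrangXi Q A f b c α x ςb ≤ primalP Q A f b c α x := by
    unfold primalP GaoStrangXi
    gcongr with i _
    have ha := hα i
    generalize (1 / 2) * (x ⬝ᵥ (A i).mulVec x) + b i ⬝ᵥ x + c i = L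
    have : α i / 2 * L ^ 2 - (L * ςb i - ςb i ^ 2 / (2 * α i))
        = (α i * L - ςb i) ^ 2 / (2 * α i) := by
      field_simp
      ring
    have h2 : 0 ≤ (α i * L - ςb i) ^ 2 / (2 * α i) := by positivity
    linarith
  rw [hP]
  refine le_trans ?_ hP2
  rw [xi_eq_dual Q A f b c α hQ hA xb ςb hdet, xi_eq_dual Q A f b c α hQ hA x ςb hdet, hx]
  have := hG.inv.posSemidef.dotProduct_mulVec_nonneg ((Gmat Q A ςb).mulVec x - Fvec f b ςb)
  simp only [star_trivial] at this
  simp only [zero_dotProduct]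
  linarith
end

section
/- Weak duality: suppose every α_i > 0 and ς ∈ ℝ^m is such that G(ς) is positive definite. Then for every x ∈ ℝⁿ, P^d(ς) ≤ P(x). -/
open Matrix

/-- Weak duality: if every `αᵢ > 0` and `G(ς)` is positive definite, then
`P^d(ς) ≤ P(x)` for every `x`. -/
theorem weak_duality {n m : ℕ} (Q : Matrix (Fin n) (Fin n) ℝ)
    (A : Fin m → Matrix (Fin n) (Fin n) ℝ) (f : Fin n → ℝ) (b : Fin m → Fin n → ℝ)
    (c α : Fin m → ℝ) (hQ : Q.IsSymm) (hA : ∀ i, (A i).IsSymm)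
    (hα : ∀ i, 0 < α i) (ς : Fin m → ℝ) (hG : (Gmat Q A ς).PosDef) :
    ∀ x : Fin n → ℝ, dualP Q A f b c α ς ≤ primalP Q A f b c α x := by
  intro x
  have hdet : IsUnit (Gmat Q A ς).det := hG.det_pos.ne'.isUnit
  obtain ⟨y, hy⟩ : ∃ y, y = (Gmat Q A ς)⁻¹.mulVec (Fvec f b ς) := ⟨_, rfl⟩
  have hGy : (Gmat Q A ς).mulVec y = Fvec f b ς := by
    rw [hy, Matrix.mulVec_mulVec, Matrix.mul_nonsing_inv _ hdet, Matrix.one_mulVec]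
  have hsymm : (Gmat Q A ς)ᵀ = Gmat Q A ς := by
    have := hG.isHermitian.eq
    rwa [Matrix.conjTranspose_eq_transpose_of_trivial] at this
  have hnn : 0 ≤ (x - y) ⬝ᵥ (Gmat Q A ς).mulVec (x - y) := by
    simpa using hG.posSemidef.dotProduct_mulVec_nonneg (x - y)
  have hyx : y ⬝ᵥ (Gmat Q A ς).mulVec x = x ⬝ᵥ Fvec f b ς := by
    rw [Matrix.dotProduct_mulVec, ← Matrix.mulVec_transpose, hsymm, hGy, dotProduct_comm]
  rw [Matrix.mulVec_sub, hGy, sub_dotProduct, dotProduct_sub, dotProduct_sub, hyx] at hnn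
  have hxG : x ⬝ᵥ (Gmat Q A ς).mulVec x
      = x ⬝ᵥ Q.mulVec x + ∑ i, ς i * (x ⬝ᵥ (A i).mulVec x) := by
    simp [Gmat, Matrix.add_mulVec, Matrix.sum_mulVec, dotProduct_sum, Matrix.smul_mulVec]
  have hxF : x ⬝ᵥ Fvec f b ς = x ⬝ᵥ f - ∑ i, ς i * (b i ⬝ᵥ x) := by
    simp [Fvec, sum_dotProduct, dotProduct_comm x]
  have hsum : ∑ i, (c i * ς i - ς i ^ 2 / (2 * α i))
      + (1 / 2) * ∑ i, ς i * (x ⬝ᵥ (A i).mulVec x) + ∑ i, ς i * (b i ⬝ᵥ x)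
      ≤ ∑ i, α i / 2 * ((1 / 2) * (x ⬝ᵥ (A i).mulVec x) + b i ⬝ᵥ x + c i) ^ 2 := by
    rw [Finset.mul_sum, ← Finset.sum_add_distrib, ← Finset.sum_add_distrib]
    refine Finset.sum_le_sum fun i _ => ?_
    have ha := hα i
    generalize x ⬝ᵥ (A i).mulVec x = u
    generalize b i ⬝ᵥ x = v
    have h : 0 ≤ α i / 2 * ((1 / 2 * u + v + c i) - ς i / α i) ^ 2 := by positivity
    have e : α i / 2 * ((1 / 2 * u + v + c i) - ς i / α i) ^ 2
        = α i / 2 * (1 / 2 * u + v + c i) ^ 2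
          - (c i * ς i - ς i ^ 2 / (2 * α i) + 1 / 2 * (ς i * u) + ς i * v) := by
      field_simp
      ring
    linarith
  have hyF : y ⬝ᵥ Fvec f b ς = Fvec f b ς ⬝ᵥ y := dotProduct_comm _ _
  unfold dualP primalP
  rw [← hy]
  linarith
end

section
/- Perfect duality for the double-well potential: the infimum of P(x) = ½(½x² − 2)² − ½x over all x ∈ ℝ equals the supremum of P^d(ς) = −1/(8ς) − ½ς² − 2ς over all ς > 0, and both are attained. -/
/-- The double-well potential `P(x) = ½(½x² − 2)² − ½x`. -/
noncomputable def doubleWellP (x : ℝ) : ℝ :=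
  (1 / 2) * ((1 / 2) * x ^ 2 - 2) ^ 2 - (1 / 2) * x

/-- Canonical dual of the double-well potential, `P^d(ς) = −1/(8ς) − ½ς² − 2ς`. -/
noncomputable def doubleWellPd (ς : ℝ) : ℝ :=
  -1 / (8 * ς) - (1 / 2) * ς ^ 2 - 2 * ς

/-- Gao–Strang complementary function of the double-well potential,
`Ξ(x,ς) = (½x² − 2)ς − ½ς² − ½x`. -/
noncomputable def doubleWellXi (x ς : ℝ) : ℝ :=
  ((1 / 2) * x ^ 2 - 2) * ς - (1 / 2) * ς ^ 2 - (1 / 2) * x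


theorem doubleWell_gap (x s : ℝ) (hs : 0 < s) :
    doubleWellP x - doubleWellPd s =
      (1 / 2) * ((1 / 2) * x ^ 2 - 2 - s) ^ 2 + (s / 2) * (x - 1 / (2 * s)) ^ 2 := by
  unfold doubleWellP doubleWellPd
  field_simp
  ring

theorem doubleWell_weak (x s : ℝ) (hs : 0 < s) : doubleWellPd s ≤ doubleWellP x := by
  have h := doubleWell_gap x s hs
  have : 0 ≤ (1 / 2) * ((1 / 2) * x ^ 2 - 2 - s) ^ 2 + (s / 2) * (x - 1 / (2 * s)) ^ 2 := by
    positivity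
  linarith

/-- Perfect duality for the double-well potential: `inf_x P(x) = sup_{ς > 0} P^d(ς)`,
both attained. -/
theorem doubleWell_perfect_duality :
    ∃ xb : ℝ, ∃ ςb : ℝ, 0 < ςb ∧
      (∀ x : ℝ, doubleWellP xb ≤ doubleWellP x) ∧
      (∀ ς : ℝ, 0 < ς → doubleWellPd ς ≤ doubleWellPd ςb) ∧
      doubleWellP xb = doubleWellPd ςb := by
  obtain ⟨s, hs, h⟩ : ∃ s : ℝ, 0 < s ∧ 8 * s ^ 2 * (s + 2) = 1 := by
    have hc : ContinuousOn (fun s : ℝ => 8 * s ^ 2 * (s + 2)) (Set.Icc 0 1) := by fun_prop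
    obtain ⟨s, hs, h⟩ := intermediate_value_Icc (by norm_num : (0 : ℝ) ≤ 1) hc
      (show (1 : ℝ) ∈ _ by constructor <;> norm_num)
    refine ⟨s, lt_of_le_of_ne hs.1 ?_, h⟩
    rintro rfl
    norm_num at h
  have e : doubleWellP (1 / (2 * s)) = doubleWellPd s := by
    have g := doubleWell_gap (1 / (2 * s)) s hs
    have k : (1 / 2) * (1 / (2 * s)) ^ 2 - 2 - s = 0 := by
      field_simp
      linarith
    rw [k] at g
    simp only [sub_self] at g
    linarith
  refine ⟨1 / (2 * s), s, hs, fun x => ?_, fun t ht => ?_, e⟩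
  · rw [e]
    exact doubleWell_weak x s hs
  · rw [← e]
    exact doubleWell_weak _ t ht
end

section
/- If (x̄, ς̄) ∈ ℝ × ℝ is a critical point of the Gao–Strang complementary function Ξ(x,ς) = (½x² − 2)ς − ½ς² − ½x of the double-well potential, i.e. x̄·ς̄ = ½ and ς̄ = ½x̄² − 2, then P(x̄) = Ξ(x̄, ς̄) = P^d(ς̄); if moreover ς̄ > 0, then x̄ is a global minimizer of P on ℝ. -/
/-- At any critical point `(x̄, ς̄)` of the Gao–Strang complementary function `Ξ` of the
double-well potential, `P(x̄) = Ξ(x̄, ς̄) = P^d(ς̄)`; if moreover `ς̄ > 0`, then `x̄` is a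
global minimizer of `P` on `ℝ`. -/
theorem doubleWellXi_critical (xb ςb : ℝ) (h1 : xb * ςb = 1 / 2)
    (h2 : ςb = (1 / 2) * xb ^ 2 - 2) :
    doubleWellP xb = doubleWellXi xb ςb ∧
      doubleWellXi xb ςb = doubleWellPd ςb ∧
      (0 < ςb → ∀ x : ℝ, doubleWellP xb ≤ doubleWellP x) := by
  have hP : doubleWellP xb = doubleWellXi xb ςb := by
    unfold doubleWellP doubleWellXi
    rw [← h2]
    ring
  refine ⟨hP, ?_, ?_⟩
  · have hs : ςb ≠ 0 := by
      rintro h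
      rw [h] at h1
      norm_num at h1
    have hd : -1 / (8 * ςb) = -(xb / 4) := by
      rw [div_eq_iff (by positivity)]
      linear_combination 2 * h1
    unfold doubleWellXi doubleWellPd
    rw [hd]
    linear_combination (xb / 2) * h1
  · intro hpos x
    rw [hP]
    have e : doubleWellP x - doubleWellXi xb ςb =
        (1 / 2) * ((1 / 2) * x ^ 2 - 2 - ςb) ^ 2 + (1 / 2) * ςb * (x - xb) ^ 2 := by
      unfold doubleWellP doubleWellXi
      linear_combination (x - xb) * h1
    have : 0 ≤ (1 / 2) * ((1 / 2) * x ^ 2 - 2 - ςb) ^ 2 + (1 / 2) * ςb * (x - xb) ^ 2 := by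
      positivity
    linarith
end
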